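/- arXiv:2410.17447 — 2 statements merged into one kernel-verified Lean document; each statement's English description precedes it below -/
import Mathlib

section
/- For every integer k ≥ 0, real δ > -1, every n ≥ 0, every m ∈ {0,…,k} and every m-simplex σ of the preferential attachment simplicial complex G_n: if the m-degree of σ in G_n equals i (necessarily i ≥ k−m+1), then the number of k-simplices of G_n containing σ equals (i−k+m)(k−m)+1, and the sum of the k-degrees of the k-simplices of G_n containing σ equals (i−k+m)(k−m+1). -/
open MeasureTheory Filter Finset

noncomputable section

instance : MeasurableSpace (Finset ℕ) := ⊤
instance : MeasurableSpace (Finset (Finset ℕ)) := ⊤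

/-- The `m`-degree of an `m`-simplex `s` in the simplicial complex `g`: the number of
`(m+1)`-simplices (i.e. sets of cardinality `m+2`) of `g` containing `s`. -/
def simDeg (m : ℕ) (g : Finset (Finset ℕ)) (s : Finset ℕ) : ℕ :=
  (g.filter fun t => s ⊆ t ∧ t.card = m + 2).card

/-- The initial complex: one `(k+1)`-simplex on the vertex set `{1, …, k+2}` together
with all its (nonempty) subsimplices. -/
def initComplex (k : ℕ) : Finset (Finset ℕ) :=
  (Finset.Icc 1 (k + 2)).powerset.filter fun s => s.Nonempty

/-- Add to `g` the simplex `s ∪ {v}` together with all of its (nonempty) subsimplices. -/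
def addSimplex (g : Finset (Finset ℕ)) (s : Finset ℕ) (v : ℕ) : Finset (Finset ℕ) :=
  g ∪ (insert v s).powerset.filter fun t => t.Nonempty

/-- The set of `k`-simplices (sets of cardinality `k+1`) of the complex `g`. -/
def kSimplices (k : ℕ) (g : Finset (Finset ℕ)) : Finset (Finset ℕ) :=
  g.filter fun s => s.card = k + 1

/-- The preferential attachment simplicial complex with parameters `k` and `δ`:
`G n ω` is the complex at time `n`, `choice n ω` is the `k`-simplex selected by the vertex
arriving at time `n ≥ 1`, chosen among the `k`-simplices of `G (n-1)` with conditional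
probability proportional to its `k`-degree plus `δ`. -/
structure PAComplex (k : ℕ) (δ : ℝ) (Ω : Type*) [MeasurableSpace Ω] where
  μ : Measure Ω
  isProb : IsProbabilityMeasure μ
  G : ℕ → Ω → Finset (Finset ℕ)
  choice : ℕ → Ω → Finset ℕ
  meas_G : ∀ n, Measurable (G n)
  meas_choice : ∀ n, Measurable (choice n)
  init : ∀ ω, G 0 ω = initComplex k
  choice_mem : ∀ n ω, 1 ≤ n → choice n ω ∈ kSimplices k (G (n - 1) ω)
  step : ∀ n ω, 1 ≤ n → G n ω = addSimplex (G (n - 1) ω) (choice n ω) (n + k + 2)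
  cond_law : ∀ n : ℕ, 1 ≤ n → ∀ g : ℕ → Finset (Finset ℕ),
    ∀ s ∈ kSimplices k (g (n - 1)),
      μ {ω | choice n ω = s ∧ ∀ j < n, G j ω = g j}
        = ENNReal.ofReal (((simDeg k (g (n - 1)) s : ℝ) + δ) /
            ∑ t ∈ kSimplices k (g (n - 1)), ((simDeg k (g (n - 1)) t : ℝ) + δ)) *
          μ {ω | ∀ j < n, G j ω = g j}

/-- The `c` largest vertices of the simplex `s` (so for an enumeration
`s = {v_0 < v_1 < ⋯ < v_k}` and `c = m+1` this is the youngest `m`-simplex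
`{v_{k-m}, …, v_k}`). -/
def topSub (s : Finset ℕ) (c : ℕ) : Finset ℕ :=
  s.filter fun v => (s.filter fun w => v < w).card < c

/-- `Ncount k g i` is the number of `k`-simplices `s = {v_0 < ⋯ < v_k}` of `g` such that
for each `m = 0, …, k` the `m`-degree of the youngest `m`-simplex `{v_{k-m}, …, v_k}`
equals `i m`. -/
def Ncount (k : ℕ) (g : Finset (Finset ℕ)) (i : Fin (k + 1) → ℕ) : ℕ :=
  ((kSimplices k g).filter fun s =>
    ∀ m : Fin (k + 1), simDeg (m : ℕ) g (topSub s ((m : ℕ) + 1)) = i m).card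

/-- The number of sets of cardinality `j` in `g` containing `s`. -/
def cofaceCount (g : Finset (Finset ℕ)) (s : Finset ℕ) (j : ℕ) : ℕ :=
  (g.filter fun t => s ⊆ t ∧ t.card = j).card

lemma simDeg_eq_cofaceCount (m : ℕ) (g : Finset (Finset ℕ)) (s : Finset ℕ) :
    simDeg m g s = cofaceCount g s (m + 2) := rfl

lemma card_filter_kSimplices (k : ℕ) (g : Finset (Finset ℕ)) (s : Finset ℕ) :
    ((kSimplices k g).filter fun t => s ⊆ t).card = cofaceCount g s (k + 1) := by
  unfold kSimplices cofaceCount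
  rw [filter_filter]
  simp only [and_comm]

lemma cofaceCount_congr {g h : Finset (Finset ℕ)} {s : Finset ℕ} {j : ℕ}
    (H : ∀ t, s ⊆ t → (t ∈ g ↔ t ∈ h)) : cofaceCount g s j = cofaceCount h s j := by
  unfold cofaceCount
  congr 1
  ext t
  simp only [mem_filter]
  constructor
  · rintro ⟨h1, h2, h3⟩
    exact ⟨(H t h2).1 h1, h2, h3⟩
  · rintro ⟨h1, h2, h3⟩
    exact ⟨(H t h2).2 h1, h2, h3⟩

lemma cofaceCount_powerset {a s : Finset ℕ} (h : s ⊆ a) (d : ℕ) :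
    cofaceCount a.powerset s (s.card + d) = (a.card - s.card).choose d := by
  rw [← card_sdiff_of_subset h, ← card_powersetCard]
  unfold cofaceCount
  refine card_bij' (fun t _ => t \ s) (fun t _ => t ∪ s) ?_ ?_ ?_ ?_
  · intro t ht
    simp only [mem_filter, mem_powerset, mem_powersetCard] at ht ⊢
    refine ⟨sdiff_subset_sdiff ht.1 le_rfl, ?_⟩
    rw [card_sdiff_of_subset ht.2.1, ht.2.2]
    omega
  · intro t ht
    simp only [mem_filter, mem_powerset, mem_powersetCard] at ht ⊢
    refine ⟨union_subset (ht.1.trans sdiff_subset) h, subset_union_right, ?_⟩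
    rw [card_union_of_disjoint (disjoint_sdiff.symm.mono_left ht.1), ht.2]
    omega
  · intro t ht
    simp only [mem_filter] at ht
    exact sdiff_union_of_subset ht.2.1
  · intro t ht
    simp only [mem_powersetCard] at ht
    exact union_sdiff_cancel_right (disjoint_sdiff.symm.mono_left ht.1)

lemma cofaceCount_of_lt {g : Finset (Finset ℕ)} {s : Finset ℕ} {j : ℕ} (h : j < s.card) :
    cofaceCount g s j = 0 := by
  unfold cofaceCount
  rw [card_eq_zero, filter_eq_empty_iff]
  rintro t - ⟨h1, h2⟩
  have := card_le_card h1
  omega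

lemma mem_addSimplex {g : Finset (Finset ℕ)} {c t : Finset ℕ} {v : ℕ} :
    t ∈ addSimplex g c v ↔ t ∈ g ∨ t ⊆ insert v c ∧ t.Nonempty := by
  simp [addSimplex]

/-- The properties of a finite complex on `{0, …, V}` preserved by preferential attachment: it is
closed under passing to nonempty subsets, and the numbers of cofaces of an `m`-simplex `s` in
dimensions `m + 1` and `k` are determined by the number of `(k+1)`-simplices containing `s`. -/
structure IsDegreeRegular (k V : ℕ) (g : Finset (Finset ℕ)) : Prop where
  bound : ∀ t ∈ g, ∀ x ∈ t, x ≤ V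
  closed : ∀ t ∈ g, ∀ u ⊆ t, u.Nonempty → u ∈ g
  count : ∀ m ≤ k, ∀ s ∈ g, s.card = m + 1 →
    1 ≤ cofaceCount g s (k + 2) ∧
    cofaceCount g s (m + 2) = (k - m) + cofaceCount g s (k + 2) ∧
    cofaceCount g s (k + 1) = cofaceCount g s (k + 2) * (k - m) + 1

lemma cofaceCount_simplex {k m : ℕ} (hm : m ≤ k) {a s : Finset ℕ} (h : s ⊆ a)
    (ha : a.card = k + 2) (hs : s.card = m + 1) :
    cofaceCount a.powerset s (k + 2) = 1 ∧
    cofaceCount a.powerset s (m + 2) = (k - m) + 1 ∧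
    cofaceCount a.powerset s (k + 1) = (k - m) + 1 := by
  obtain ⟨e, rfl⟩ := Nat.exists_eq_add_of_le hm
  have key := cofaceCount_powerset h
  rw [ha, hs] at key
  have e0 : m + e + 2 - (m + 1) = e + 1 := by omega
  rw [e0] at key
  refine ⟨?_, ?_, ?_⟩
  · rw [show m + e + 2 = m + 1 + (e + 1) by ring, key, Nat.choose_self]
  · rw [show m + 2 = m + 1 + 1 by ring, key, Nat.choose_one_right]
    omega
  · rw [show m + e + 1 = m + 1 + e by ring, key, Nat.choose_succ_self_right]
    omega

lemma isDegreeRegular_initComplex (k : ℕ) : IsDegreeRegular k (k + 2) (initComplex k) where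
  bound t ht x hx := by
    simp only [initComplex, mem_filter, mem_powerset] at ht
    exact (mem_Icc.1 (ht.1 hx)).2
  closed t ht u hu hne := by
    simp only [initComplex, mem_filter, mem_powerset] at ht ⊢
    exact ⟨hu.trans ht.1, hne⟩
  count m hm s hs hcard := by
    simp only [initComplex, mem_filter, mem_powerset] at hs
    have H (j : ℕ) : cofaceCount (initComplex k) s j =
        cofaceCount (Finset.Icc 1 (k + 2)).powerset s j := by
      refine cofaceCount_congr fun t ht => ?_
      simp only [initComplex, mem_filter]
      exact and_iff_left (hs.2.mono ht)
    obtain ⟨h1, h2, h3⟩ := cofaceCount_simplex hm hs.1 (by simp) hcard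
    rw [H, H, H, h1, h2, h3]
    omega

lemma cofaceCount_addSimplex_of_not_subset {g : Finset (Finset ℕ)} {c s : Finset ℕ} {v : ℕ}
    (hs : ¬ s ⊆ insert v c) (j : ℕ) :
    cofaceCount (addSimplex g c v) s j = cofaceCount g s j := by
  refine cofaceCount_congr fun t ht => ?_
  rw [mem_addSimplex]
  exact or_iff_left fun h => hs (ht.trans h.1)

lemma cofaceCount_addSimplex_of_mem {g : Finset (Finset ℕ)} {c s : Finset ℕ} {v : ℕ}
    (hg : ∀ t ∈ g, v ∉ t) (hs : v ∈ s) (j : ℕ) :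
    cofaceCount (addSimplex g c v) s j = cofaceCount (insert v c).powerset s j := by
  refine cofaceCount_congr fun t ht => ?_
  rw [mem_addSimplex, mem_powerset]
  constructor
  · rintro (h | h)
    · exact absurd (ht hs) (hg t h)
    · exact h.1
  · exact fun h => Or.inr ⟨h, v, ht hs⟩

lemma cofaceCount_addSimplex_of_subset {g : Finset (Finset ℕ)} {c s : Finset ℕ} {v : ℕ}
    (hg : ∀ t ∈ g, v ∉ t) (hc : ∀ u ⊆ c, u.Nonempty → u ∈ g) (j : ℕ) :
    cofaceCount (addSimplex g c v) s j =
      cofaceCount g s j + cofaceCount (insert v c).powerset (insert v s) j := by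
  unfold cofaceCount
  rw [← card_union_of_disjoint]
  · congr 1
    ext t
    simp only [mem_union, mem_filter, mem_addSimplex, mem_powerset, insert_subset_iff]
    constructor
    · rintro ⟨h | h, h2, h3⟩
      · exact Or.inl ⟨h, h2, h3⟩
      · by_cases hv : v ∈ t
        · exact Or.inr ⟨h.1, ⟨hv, h2⟩, h3⟩
        · exact Or.inl ⟨hc t ((subset_insert_iff_of_notMem hv).1 h.1) h.2, h2, h3⟩
    · rintro (⟨h, h2, h3⟩ | ⟨h, ⟨hv, h2⟩, h3⟩)
      · exact ⟨Or.inl h, h2, h3⟩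
      · exact ⟨Or.inr ⟨h, v, hv⟩, h2, h3⟩
  · rw [disjoint_left]
    intro t ht ht'
    simp only [mem_filter] at ht ht'
    exact hg t ht.1 (ht'.2.1 (mem_insert_self v s))

lemma IsDegreeRegular.addSimplex {k V : ℕ} {g : Finset (Finset ℕ)} (hg : IsDegreeRegular k V g)
    {c : Finset ℕ} (hc : c ∈ kSimplices k g) :
    IsDegreeRegular k (V + 1) (addSimplex g c (V + 1)) := by
  obtain ⟨hcg, hcc⟩ := mem_filter.1 hc
  have hv : ∀ t ∈ g, V + 1 ∉ t := fun t ht h => by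
    have := hg.bound t ht _ h
    omega
  have hcard : (insert (V + 1) c).card = k + 2 := by
    rw [card_insert_of_notMem (hv c hcg), hcc]
  refine ⟨fun t ht x hx => ?_, fun t ht u hu hne => ?_, fun m hm s hs hsc => ?_⟩
  · rcases mem_addSimplex.1 ht with h | h
    · exact (hg.bound t h x hx).trans (Nat.le_succ V)
    · rcases mem_insert.1 (h.1 hx) with rfl | h'
      · exact le_rfl
      · exact (hg.bound c hcg x h').trans (Nat.le_succ V)
  · rw [mem_addSimplex] at ht ⊢
    exact ht.imp (fun h => hg.closed t h u hu hne) fun h => ⟨hu.trans h.1, hne⟩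
  · by_cases hvs : V + 1 ∈ s
    · have hsc' : s ⊆ insert (V + 1) c := by
        rcases mem_addSimplex.1 hs with h | h
        · exact absurd hvs (hv s h)
        · exact h.1
      obtain ⟨h1, h2, h3⟩ := cofaceCount_simplex hm hsc' hcard hsc
      simp only [cofaceCount_addSimplex_of_mem hv hvs]
      rw [h1, h2, h3, one_mul]
      exact ⟨le_rfl, rfl, rfl⟩
    · have hsg : s ∈ g := by
        rcases mem_addSimplex.1 hs with h | h
        · exact h
        · exact hg.closed c hcg s ((subset_insert_iff_of_notMem hvs).1 h.1) h.2
      obtain ⟨h1, h2, h3⟩ := hg.count m hm s hsg hsc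
      by_cases hsub : s ⊆ insert (V + 1) c
      · simp only [cofaceCount_addSimplex_of_subset hv (hg.closed c hcg)]
        have hic : (insert (V + 1) s).card = m + 2 := by
          rw [card_insert_of_notMem hvs, hsc]
        have key := cofaceCount_powerset (insert_subset (mem_insert_self _ _) hsub)
        rw [hcard, hic] at key
        obtain ⟨e, rfl⟩ := Nat.exists_eq_add_of_le hm
        have he : m + e + 2 - (m + 2) = e := by omega
        rw [he] at key
        have k1 := key 0
        have k2 := key e
        rw [Nat.choose_zero_right, add_zero] at k1
        rw [Nat.choose_self, show m + 2 + e = m + e + 2 by ring] at k2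
        have k3 : cofaceCount (insert (V + 1) c).powerset (insert (V + 1) s) (m + e + 1) = e := by
          rcases e with _ | e
          · exact cofaceCount_of_lt (by omega)
          · rw [show m + (e + 1) + 1 = m + 2 + e by ring, key, Nat.choose_succ_self_right]
        rw [k1, k2, k3, h2, h3, Nat.add_sub_cancel_left]
        refine ⟨by omega, by ring, by ring⟩
      · simp only [cofaceCount_addSimplex_of_not_subset hsub]
        exact ⟨h1, h2, h3⟩

lemma PAComplex.isDegreeRegular {k : ℕ} {δ : ℝ} {Ω : Type*} [MeasurableSpace Ω]
    (M : PAComplex k δ Ω) (n : ℕ) (ω : Ω) : IsDegreeRegular k (n + k + 2) (M.G n ω) := by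
  induction n with
  | zero =>
    rw [M.init, zero_add]
    exact isDegreeRegular_initComplex k
  | succ n ih =>
    rw [M.step (n + 1) ω (Nat.le_add_left 1 n), show n + 1 + k + 2 = n + k + 2 + 1 by ring]
    exact ih.addSimplex (M.choice_mem (n + 1) ω (Nat.le_add_left 1 n))

lemma sum_simDeg_kSimplices {k m : ℕ} {g : Finset (Finset ℕ)}
    (hg : ∀ t ∈ g, ∀ u ⊆ t, u.Nonempty → u ∈ g) (hm : m ≤ k) {s : Finset ℕ}
    (hcard : s.card = m + 1) :
    ∑ t ∈ (kSimplices k g).filter (fun t => s ⊆ t), simDeg k g t =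
      cofaceCount g s (k + 2) * (k - m + 1) := by
  have hne : s.Nonempty := card_pos.1 (by omega)
  have hL : ∀ t ∈ (kSimplices k g).filter (fun t => s ⊆ t), simDeg k g t =
      (bipartiteAbove (· ⊆ ·) (g.filter fun u => s ⊆ u ∧ u.card = k + 2) t).card := by
    intro t ht
    have hst := (mem_filter.1 ht).2
    unfold simDeg bipartiteAbove
    rw [filter_filter]
    congr 1
    refine filter_congr fun u _ => ?_
    exact ⟨fun h => ⟨⟨hst.trans h.1, h.2⟩, h.1⟩, fun h => ⟨h.2, h.1.2⟩⟩
  have hR : ∀ u ∈ g.filter (fun u => s ⊆ u ∧ u.card = k + 2),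
      (bipartiteBelow (· ⊆ ·) ((kSimplices k g).filter (fun t => s ⊆ t)) u).card =
        k - m + 1 := by
    intro u hu
    obtain ⟨hug, hsu, huc⟩ := mem_filter.1 hu
    rw [← (cofaceCount_simplex hm hsu huc hcard).2.2]
    unfold cofaceCount bipartiteBelow kSimplices
    congr 1
    ext t
    simp only [mem_filter, mem_powerset]
    constructor
    · rintro ⟨⟨⟨-, h2⟩, h3⟩, h4⟩
      exact ⟨h4, h3, h2⟩
    · rintro ⟨h4, h3, h2⟩
      exact ⟨⟨⟨hg u hug t h4 (hne.mono h3), h2⟩, h3⟩, h4⟩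
  rw [sum_congr rfl hL, sum_card_bipartiteAbove_eq_sum_card_bipartiteBelow, sum_congr rfl hR,
    sum_const, smul_eq_mul, cofaceCount]

/-- With probability one: if an `m`-simplex `s` of `G_n` (for `m ≤ k`) has `m`-degree `i`
(necessarily `i ≥ k - m + 1`), then the number of `k`-simplices of `G_n` containing `s`
equals `(i - k + m)(k - m) + 1` and the sum of the `k`-degrees of the `k`-simplices of
`G_n` containing `s` equals `(i - k + m)(k - m + 1)`. -/
theorem simplices_containing_m_simplex (k : ℕ) (δ : ℝ) (hδ : -1 < δ)
    (Ω : Type*) [MeasurableSpace Ω] (M : PAComplex k δ Ω) (n m : ℕ) (hm : m ≤ k) :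
    ∀ᵐ ω ∂M.μ, ∀ s ∈ M.G n ω, s.card = m + 1 →
      k - m + 1 ≤ simDeg m (M.G n ω) s ∧
      ∀ i : ℕ, simDeg m (M.G n ω) s = i →
        ((kSimplices k (M.G n ω)).filter fun t => s ⊆ t).card
            = (i - (k - m)) * (k - m) + 1 ∧
        ∑ t ∈ (kSimplices k (M.G n ω)).filter (fun t => s ⊆ t), simDeg k (M.G n ω) t
            = (i - (k - m)) * (k - m + 1) := by
  refine ae_of_all _ fun ω s hs hcard => ?_
  obtain ⟨-, hclosed, hcount⟩ := M.isDegreeRegular n ω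
  obtain ⟨h1, h2, h3⟩ := hcount m hm s hs hcard
  refine ⟨by rw [simDeg_eq_cofaceCount, h2]; omega, ?_⟩
  rintro i rfl
  have hT : simDeg m (M.G n ω) s - (k - m) = cofaceCount (M.G n ω) s (k + 2) := by
    rw [simDeg_eq_cofaceCount, h2]; omega
  rw [hT, card_filter_kSimplices]
  exact ⟨h3, sum_simDeg_kSimplices hclosed hm hcard⟩
end
end

section
/- Let Z be a Pareto random variable with density f_Z(z) = (τ/b_0) z^{−(1+τ/b_0)}, z ≥ 1, and, conditionally on Z = z, let T_m (m = 0,…,k) and the i.i.d. copies (N_{0,j}^{(m)},…,N_{m-1,j}^{(m)}), j ≥ 1 (m = 1,…,k), be as in the compound negative-binomial construction. Then the random vector (k−i+1 + T_i + Σ_{m=i+1}^{k} Σ_{j=1}^{T_m} N_{i,j}^{(m)}, i = 0,…,k) has the probability mass function P(D^{(m)} = i_m, m = 0,…,k) = p_{i_0,…,i_k} for 1 ≤ i_k < ⋯ < i_0, where (p_{i_0,…,i_k}) is the unique solution of the limiting degree recursion. -/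
open MeasureTheory Filter Finset

noncomputable section

/-- The coefficient `b_m = k - m + 1 + δ(k - m)`. -/
def bcoef (k : ℕ) (δ : ℝ) (m : ℕ) : ℝ := (k : ℝ) - m + 1 + δ * ((k : ℝ) - m)

/-- The coefficient `τ = k + 2 + δ(k + 1)`. -/
def tauc (k : ℕ) (δ : ℝ) : ℝ := (k : ℝ) + 2 + δ * ((k : ℝ) + 1)

/-- A vector `(i_0, …, i_k)` of degrees is valid when `1 ≤ i_k < i_{k-1} < ⋯ < i_0`. -/
def ValidIdx (k : ℕ) (i : Fin (k + 1) → ℕ) : Prop :=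
  1 ≤ i (Fin.last k) ∧ StrictAnti i

/-- Decrease every coordinate of the index vector by one. -/
def allDec (k : ℕ) (i : Fin (k + 1) → ℕ) : Fin (k + 1) → ℕ := fun ℓ => i ℓ - 1

/-- Decrease the coordinates `0, …, m` of the index vector by one. -/
def decUpTo (k : ℕ) (m : ℕ) (i : Fin (k + 1) → ℕ) : Fin (k + 1) → ℕ :=
  fun ℓ => if (ℓ : ℕ) ≤ m then i ℓ - 1 else i ℓ

/-- The limiting degree recursion: `p` vanishes outside the valid index vectors, and on the
valid index vectors it satisfies the recursion of Theorem 2.1 of the paper. -/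
def LimitRecursion (k : ℕ) (δ : ℝ) (p : (Fin (k + 1) → ℕ) → ℝ) : Prop :=
  (∀ i, ¬ ValidIdx k i → p i = 0) ∧
  ∀ i, ValidIdx k i →
    p i = ((i (Fin.last k) : ℝ) - 1 + δ) / tauc k δ * p (allDec k i)
      + (∑ m : Fin k,
          (((i m.castSucc : ℝ) - 1 - k + (m : ℕ)) * bcoef k δ (m : ℕ)
            - ((i m.succ : ℝ) - k + (m : ℕ) + 1) * bcoef k δ ((m : ℕ) + 1)) / tauc k δ
            * p (decUpTo k (m : ℕ) i))
      - (((i 0 : ℝ) - k) * bcoef k δ 0 + δ) / tauc k δ * p i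
      + (if ∀ ℓ : Fin (k + 1), i ℓ = k - (ℓ : ℕ) + 1 then (1 : ℝ) else 0)

/-- The negative binomial pmf with shape `r` and success probability `a`. -/
def nbWeight (r a : ℝ) (ℓ : ℕ) : ℝ :=
  Real.Gamma ((ℓ : ℝ) + r) / ((ℓ.factorial : ℝ) * Real.Gamma r) * (1 - a) ^ ℓ * a ^ r

/-- The extended truncated negative binomial pmf with parameters `κ` and `a`. -/
def tnbWeight (κ a : ℝ) (ℓ : ℕ) : ℝ :=
  if ℓ = 0 then 0
  else κ * Real.Gamma ((ℓ : ℝ) - κ) / ((ℓ.factorial : ℝ) * Real.Gamma (1 - κ))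
    * (1 - a) ^ ℓ / (1 - a ^ κ)

/-- The measure on `ℕ` with mass function `f`. -/
def natMeasure (f : ℕ → ℝ) : Measure ℕ :=
  Measure.sum fun ℓ => ENNReal.ofReal (f ℓ) • Measure.dirac ℓ

/-- `ℓ`-fold convolution power of a measure on `Fin m → ℕ`, i.e. the law of a sum of `ℓ`
i.i.d. vectors of law `ν`. -/
def convPow {m : ℕ} (ν : Measure (Fin m → ℕ)) : ℕ → Measure (Fin m → ℕ)
  | 0 => Measure.dirac 0
  | ℓ + 1 => (ν.prod (convPow ν ℓ)).map fun p => p.1 + p.2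

/-- The law of the random vector `(N_0^{(m)}, …, N_{m-1}^{(m)})` from the compound
negative-binomial construction with parameter `z`: the last coordinate `N_{m-1}^{(m)}` is
extended truncated negative binomial with parameters `b_m / b_{m-1}` and `z^{-b_{m-1}/b_0}`,
and conditionally on `N_{m-1}^{(m)} = ℓ` the first `m - 1` coordinates form the sum of `ℓ`
i.i.d. copies of `(N_0^{(m-1)}, …, N_{m-2}^{(m-1)})`. -/
def vecLaw (k : ℕ) (δ : ℝ) (z : ℝ) : (m : ℕ) → Measure (Fin m → ℕ)
  | 0 => Measure.dirac 0
  | m + 1 =>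
    (natMeasure (tnbWeight (bcoef k δ (m + 1) / bcoef k δ m)
        (z ^ (-(bcoef k δ m / bcoef k δ 0))))).bind
      fun ℓ => (convPow (vecLaw k δ z m) ℓ).map fun v => Fin.snoc v ℓ

/-- The joint law of `(T_m, Σ_{j=1}^{T_m} (N_{0,j}^{(m)}, …, N_{m-1,j}^{(m)}))`, where
`T_m` is negative binomial with shape `(1+δ)/b_m` and success probability `z^{-b_m/b_0}`,
and the summands are i.i.d. copies of `(N_0^{(m)}, …, N_{m-1}^{(m)})` independent of `T_m`. -/
def pairLaw (k : ℕ) (δ : ℝ) (z : ℝ) (m : ℕ) : Measure (ℕ × (Fin m → ℕ)) :=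
  (natMeasure (nbWeight ((1 + δ) / bcoef k δ m) (z ^ (-(bcoef k δ m / bcoef k δ 0))))).bind
    fun t => (convPow (vecLaw k δ z m) t).map fun v => (t, v)

/-- The joint law of the independent family
`((T_m, Σ_{j=1}^{T_m} N_{·,j}^{(m)}))_{m = 0, …, k}` given `z`. -/
def jointLaw (k : ℕ) (δ : ℝ) (z : ℝ) :
    Measure (∀ m : Fin (k + 1), ℕ × (Fin (m : ℕ) → ℕ)) :=
  Measure.pi fun m => pairLaw k δ z (m : ℕ)

/-- Assembles the degree vector: coordinate `i` is
`k - i + 1 + T_i + Σ_{m=i+1}^{k} Σ_{j=1}^{T_m} N_{i,j}^{(m)}`. -/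
def assembleD (k : ℕ) (x : ∀ m : Fin (k + 1), ℕ × (Fin (m : ℕ) → ℕ)) : Fin (k + 1) → ℕ :=
  fun i => (k - (i : ℕ) + 1) + (x i).1 +
    ∑ m : Fin (k + 1), if h : (i : ℕ) < (m : ℕ) then (x m).2 ⟨(i : ℕ), h⟩ else 0

/-- Given `z`, the conditional law of the random degree vector
`(k - i + 1 + T_i + Σ_{m=i+1}^{k} Σ_{j=1}^{T_m} N_{i,j}^{(m)})_{i = 0, …, k}`. -/
def Dlaw (k : ℕ) (δ : ℝ) (z : ℝ) : Measure (Fin (k + 1) → ℕ) :=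
  (jointLaw k δ z).map (assembleD k)

section SeriesAlgebra

open MvPowerSeries

/-- Composition of the univariate power series with coefficients `g` with a multivariate
power series `W` without constant term. -/
def seriesComp (g : ℕ → ℝ) (W : MvPowerSeries ℕ ℝ) : MvPowerSeries ℕ ℝ :=
  fun d => ∑ ℓ ∈ range (d.degree + 1), g ℓ * coeff d (W ^ ℓ)

lemma coeff_seriesComp (g : ℕ → ℝ) (W : MvPowerSeries ℕ ℝ) (d : ℕ →₀ ℕ) :
    coeff d (seriesComp g W) = ∑ ℓ ∈ range (d.degree + 1), g ℓ * coeff d (W ^ ℓ) := rfl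

lemma coeff_pow_eq_zero_of_degree_lt {W : MvPowerSeries ℕ ℝ} (hW : constantCoeff W = 0)
    {d : ℕ →₀ ℕ} {ℓ : ℕ} (h : d.degree < ℓ) : coeff d (W ^ ℓ) = 0 :=
  coeff_eq_zero_of_constantCoeff_nilpotent (m := 1) (by simpa using hW) (by omega)

open scoped MvPowerSeries.WithPiTopology in
lemma hasSum_seriesComp (g : ℕ → ℝ) {W : MvPowerSeries ℕ ℝ} (hW : constantCoeff W = 0) :
    HasSum (fun ℓ => C (g ℓ) * W ^ ℓ) (seriesComp g W) := by
  rw [WithPiTopology.hasSum_iff_hasSum_coeff]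
  intro d
  simp only [coeff_C_mul, coeff_seriesComp]
  apply hasSum_sum_of_ne_finset_zero
  intro ℓ hℓ
  rw [coeff_pow_eq_zero_of_degree_lt hW (by simpa using hℓ), mul_zero]

/-- The Euler derivation `X_j ∂/∂X_j`. -/
def eulerD (j : ℕ) : Derivation ℝ (MvPowerSeries ℕ ℝ) (MvPowerSeries ℕ ℝ) :=
  (X j : MvPowerSeries ℕ ℝ) • pderiv ℝ j

lemma coeff_eulerD (j : ℕ) (f : MvPowerSeries ℕ ℝ) (d : ℕ →₀ ℕ) :
    coeff d (eulerD j f) = d j * coeff d f := by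
  simp only [eulerD, Derivation.smul_apply, smul_eq_mul]
  rw [X, coeff_monomial_mul]
  split_ifs with h
  · have h1 : 1 ≤ d j := by simpa using h
    rw [coeff_pderiv, tsub_add_cancel_of_le h]
    simp [Nat.cast_sub h1, mul_comm]
  · have h1 : d j = 0 := by simpa using h
    simp [h1]

open scoped MvPowerSeries.WithPiTopology in
lemma hasSum_eulerD (j : ℕ) {f : ℕ → MvPowerSeries ℕ ℝ} {F : MvPowerSeries ℕ ℝ}
    (h : HasSum f F) : HasSum (fun ℓ => eulerD j (f ℓ)) (eulerD j F) := by
  rw [WithPiTopology.hasSum_iff_hasSum_coeff] at h ⊢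
  intro d
  simp only [coeff_eulerD]
  exact (h d).mul_left _

/-- The coefficients of the binomial series `(1 - w)^(-r)`. -/
def risingCoeff (r : ℝ) : ℕ → ℝ
  | 0 => 1
  | ℓ + 1 => risingCoeff r ℓ * (r + ℓ) / (ℓ + 1)

lemma succ_mul_risingCoeff (r : ℝ) (ℓ : ℕ) :
    ((ℓ : ℝ) + 1) * risingCoeff r (ℓ + 1) = (r + ℓ) * risingCoeff r ℓ := by
  have : (ℓ : ℝ) + 1 ≠ 0 := by positivity
  simp only [risingCoeff]
  field_simp

open scoped MvPowerSeries.WithPiTopology in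
lemma one_sub_mul_eulerD_seriesComp (r : ℝ) {W : MvPowerSeries ℕ ℝ}
    (hW : constantCoeff W = 0) (j : ℕ) :
    (1 - W) * eulerD j (seriesComp (risingCoeff r) W)
      = C r * seriesComp (risingCoeff r) W * eulerD j W := by
  have h0 := hasSum_seriesComp (risingCoeff r) hW
  have h1 := hasSum_eulerD j h0
  have e : ∀ ℓ : ℕ, eulerD j (C (risingCoeff r ℓ) * W ^ ℓ)
      = C (ℓ * risingCoeff r ℓ) * W ^ (ℓ - 1) * eulerD j W := by
    intro ℓ
    rw [← smul_eq_C_mul, Derivation.map_smul, Derivation.leibniz_pow, smul_eq_C_mul, map_mul]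
    simp only [nsmul_eq_mul, smul_eq_mul, map_natCast]
    ring
  simp only [e] at h1
  have h2 := (hasSum_nat_add_iff' 1).2 h1
  have h3 := h1.mul_left W
  have h4 := h2.sub h3
  have h5 := (h0.mul_left (C r)).mul_right (eulerD j W)
  have h6 := h5.unique (h4.congr_fun (f := _) ?_)
  · rw [h6]
    simp
    ring
  · intro ℓ
    have : W * (C (ℓ * risingCoeff r ℓ) * W ^ (ℓ - 1) * eulerD j W)
        = C (ℓ * risingCoeff r ℓ) * W ^ ℓ * eulerD j W := by
      rcases ℓ with _ | ℓ
      · simp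
      · simp only [add_tsub_cancel_right]; ring
    rw [this]
    have h7 := succ_mul_risingCoeff r ℓ
    push_cast
    rw [h7]
    simp only [map_mul, map_add]
    ring

lemma constantCoeff_seriesComp (g : ℕ → ℝ) (W : MvPowerSeries ℕ ℝ) :
    constantCoeff (seriesComp g W) = g 0 := by
  rw [← coeff_zero_eq_constantCoeff_apply, coeff_seriesComp]
  simp

/-- The monomial `X_0 ⋯ X_{m-1}`. -/
def headMonomial (m : ℕ) : MvPowerSeries ℕ ℝ := ∏ j ∈ range m, X j

lemma headMonomial_succ (m : ℕ) : headMonomial (m + 1) = headMonomial m * X m :=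
  prod_range_succ _ _

/-- The exponent vector of `headMonomial m`. -/
def headExp (m : ℕ) : ℕ →₀ ℕ := ∑ j ∈ range m, Finsupp.single j 1

lemma headExp_apply (m j : ℕ) : headExp m j = if j < m then 1 else 0 := by
  simp [headExp, Finsupp.finsetSum_apply, Finsupp.single_apply]

lemma headMonomial_eq (m : ℕ) : headMonomial m = monomial (headExp m) 1 := by
  induction m with
  | zero => simp [headMonomial, headExp]
  | succ m ih =>
    have h : headExp (m + 1) = headExp m + Finsupp.single m 1 := sum_range_succ _ _
    rw [headMonomial_succ, ih, h, X, monomial_mul_monomial, one_mul]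

lemma coeff_headMonomial_mul (m : ℕ) (f : MvPowerSeries ℕ ℝ) (d : ℕ →₀ ℕ) :
    coeff d (headMonomial m * f) = if headExp m ≤ d then coeff (d - headExp m) f else 0 := by
  rw [headMonomial_eq, coeff_monomial_mul]
  simp

/-- The first-order differential operator `∑_{m ≤ k} b_m (U_m - U_{m+1}) X_m ∂/∂X_m` with
`U_m = X_0 ⋯ X_{m-1}`. -/
def flowD (b : ℕ → ℝ) (k : ℕ) : Derivation ℝ (MvPowerSeries ℕ ℝ) (MvPowerSeries ℕ ℝ) :=
  ∑ m ∈ range (k + 1), (C (b m) * (headMonomial m - headMonomial (m + 1))) • eulerD m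

lemma flowD_apply (b : ℕ → ℝ) (k : ℕ) (f : MvPowerSeries ℕ ℝ) :
    flowD b k f = ∑ m ∈ range (k + 1),
      C (b m) * (headMonomial m - headMonomial (m + 1)) * eulerD m f := by
  rw [flowD, ← Derivation.coeFnAddMonoidHom_apply, map_sum, Finset.sum_apply]
  rfl

lemma eulerD_X (i j : ℕ) : eulerD i (X j) = if i = j then X j else 0 := by
  rw [eulerD, Derivation.smul_apply, smul_eq_mul]
  split_ifs with h
  · subst h; simp
  · rw [pderiv_X_of_ne (Ne.symm h), mul_zero]

lemma flowD_X (b : ℕ → ℝ) {k j : ℕ} (hj : j ≤ k) :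
    flowD b k (X j) = C (b j) * (headMonomial j - headMonomial (j + 1)) * X j := by
  rw [flowD_apply, sum_eq_single j]
  · rw [eulerD_X, if_pos rfl]
  · intro i _ h
    rw [eulerD_X, if_neg h, mul_zero]
  · intro h
    simp at h
    omega

lemma one_sub_mul_flowD_seriesComp (b : ℕ → ℝ) (k : ℕ) (r : ℝ) {W : MvPowerSeries ℕ ℝ}
    (hW : constantCoeff W = 0) :
    (1 - W) * flowD b k (seriesComp (risingCoeff r) W)
      = C r * seriesComp (risingCoeff r) W * flowD b k W := by
  simp only [flowD_apply, mul_sum]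
  refine sum_congr rfl fun m _ => ?_
  linear_combination C (b m) * (headMonomial m - headMonomial (m + 1)) *
    one_sub_mul_eulerD_seriesComp r hW m

/-- If `1 - W` is an eigenvector of the flow with eigenvalue `-β U`, then `(1 - W)^(-r)` is an
eigenvector with eigenvalue `r β U`. -/
lemma flowD_seriesComp (b : ℕ → ℝ) (k : ℕ) (r β : ℝ) {W U : MvPowerSeries ℕ ℝ}
    (hW : constantCoeff W = 0) (h : flowD b k W = C β * U * (1 - W)) :
    flowD b k (seriesComp (risingCoeff r) W)
      = C (r * β) * U * seriesComp (risingCoeff r) W := by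
  have hne : (1 - W) ≠ 0 := by
    intro h0
    have := congrArg constantCoeff h0
    simp [hW] at this
  apply mul_left_cancel₀ hne
  rw [one_sub_mul_flowD_seriesComp b k r hW, h, map_mul]
  ring

/-- The series `W_m` with `W_0 = X_0` and `W_{m+1} = X_{m+1} (1 - (1 - W_m)^(b_{m+1} / b_m))`. -/
def clusterSeries (b : ℕ → ℝ) : ℕ → MvPowerSeries ℕ ℝ
  | 0 => X 0
  | m + 1 => X (m + 1) *
      (1 - seriesComp (risingCoeff (-(b (m + 1) / b m))) (clusterSeries b m))

lemma constantCoeff_clusterSeries (b : ℕ → ℝ) (m : ℕ) :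
    constantCoeff (clusterSeries b m) = 0 := by
  cases m <;> simp [clusterSeries]

lemma flowD_clusterSeries (b : ℕ → ℝ) {k : ℕ} (hb : ∀ m ≤ k, b m ≠ 0) {m : ℕ} (hm : m ≤ k) :
    flowD b k (clusterSeries b m)
      = C (b m) * headMonomial (m + 1) * (1 - clusterSeries b m) := by
  induction m with
  | zero =>
    rw [clusterSeries, flowD_X b hm]
    simp [headMonomial]
    ring
  | succ m ih =>
    have h1 := flowD_seriesComp b k (-(b (m + 1) / b m)) (b m)
      (constantCoeff_clusterSeries b m) (ih (by omega))
    have h2 : -(b (m + 1) / b m) * b m = - b (m + 1) := by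
      have := hb m (by omega)
      field_simp
    rw [h2, map_neg] at h1
    rw [clusterSeries, Derivation.leibniz, map_sub, Derivation.map_one_eq_zero, h1,
      flowD_X b hm, headMonomial_succ (m + 1)]
    simp only [smul_eq_mul]
    ring

/-- The product `∏_{m < n} (1 - W_m)^(-a / b_m)`. -/
def degreeSeries (b : ℕ → ℝ) (a : ℝ) (n : ℕ) : MvPowerSeries ℕ ℝ :=
  ∏ m ∈ range n, seriesComp (risingCoeff (a / b m)) (clusterSeries b m)

lemma flowD_degreeSeries (b : ℕ → ℝ) (a : ℝ) {k : ℕ} (hb : ∀ m ≤ k, b m ≠ 0) {n : ℕ}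
    (hn : n ≤ k + 1) :
    flowD b k (degreeSeries b a n)
      = C a * (∑ m ∈ range n, headMonomial (m + 1)) * degreeSeries b a n := by
  induction n with
  | zero => simp [degreeSeries]
  | succ n ih =>
    have h1 := flowD_seriesComp b k (a / b n) (b n) (constantCoeff_clusterSeries b n)
      (flowD_clusterSeries b hb (by omega))
    rw [div_mul_cancel₀ _ (hb n (by omega))] at h1
    rw [degreeSeries, prod_range_succ, ← degreeSeries, Derivation.leibniz, ih (by omega), h1,
      sum_range_succ]
    simp only [smul_eq_mul]
    ring

lemma coeff_zero_degreeSeries (b : ℕ → ℝ) (a : ℝ) (n : ℕ) :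
    coeff 0 (degreeSeries b a n) = 1 := by
  rw [coeff_zero_eq_constantCoeff_apply, degreeSeries, map_prod]
  exact prod_eq_one fun m _ => constantCoeff_seriesComp _ _

/-- Coefficient recursion for the degree series. -/
lemma coeff_degreeSeries_rec (b : ℕ → ℝ) (a : ℝ) {k : ℕ} (hb : ∀ m ≤ k, b m ≠ 0)
    (d : ℕ →₀ ℕ) :
    b 0 * d 0 * coeff d (degreeSeries b a (k + 1))
      = (∑ m ∈ range k, if headExp (m + 1) ≤ d then
          (b m * ((d m : ℝ) - 1) - b (m + 1) * d (m + 1) + a)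
            * coeff (d - headExp (m + 1)) (degreeSeries b a (k + 1)) else 0)
        + if headExp (k + 1) ≤ d then
          (b k * ((d k : ℝ) - 1) + a)
            * coeff (d - headExp (k + 1)) (degreeSeries b a (k + 1)) else 0 := by
  set G := degreeSeries b a (k + 1) with hG
  have h := congrArg (coeff d) (flowD_degreeSeries b a hb (le_refl (k + 1)))
  rw [← hG, flowD_apply, mul_sum, sum_mul] at h
  have e1 : ∀ m, C (b m) * (headMonomial m - headMonomial (m + 1)) * eulerD m G
      = C (b m) * (headMonomial m * eulerD m G)
        - C (b m) * (headMonomial (m + 1) * eulerD m G) := fun m => by ring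
  have e2 : ∀ m, C a * headMonomial (m + 1) * G = C a * (headMonomial (m + 1) * G) :=
    fun m => by ring
  simp only [e1, e2, map_sum, map_sub, coeff_C_mul, sum_sub_distrib] at h
  rw [sum_range_succ', sum_range_succ _ k, sum_range_succ _ k] at h
  simp only [coeff_headMonomial_mul, coeff_eulerD] at h
  have e3 : headExp 0 = 0 := by simp [headExp]
  simp only [e3, zero_le, if_true, tsub_zero] at h
  have e4 : ∀ m, headExp (m + 1) ≤ d → (((d - headExp (m + 1)) m : ℕ) : ℝ) = (d m : ℝ) - 1 := by
    intro m hm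
    have h1 := hm m
    rw [headExp_apply, if_pos (by omega)] at h1
    simp [Finsupp.tsub_apply, headExp_apply, Nat.cast_sub h1]
  have e5 : ∀ m, (((d - headExp (m + 1)) (m + 1) : ℕ) : ℝ) = (d (m + 1) : ℝ) := by
    intro m
    simp [Finsupp.tsub_apply, headExp_apply]
  have e6 : (∑ m ∈ range k, if headExp (m + 1) ≤ d then
          (b m * ((d m : ℝ) - 1) - b (m + 1) * d (m + 1) + a)
            * coeff (d - headExp (m + 1)) G else 0)
      = (∑ m ∈ range k, b m * if headExp (m + 1) ≤ d then
          (((d - headExp (m + 1)) m : ℕ) : ℝ) * coeff (d - headExp (m + 1)) G else 0)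
        - (∑ m ∈ range k, b (m + 1) * if headExp (m + 1) ≤ d then
          (((d - headExp (m + 1)) (m + 1) : ℕ) : ℝ) * coeff (d - headExp (m + 1)) G else 0)
        + ∑ m ∈ range k, a * if headExp (m + 1) ≤ d then coeff (d - headExp (m + 1)) G else 0 := by
    rw [← sum_sub_distrib, ← sum_add_distrib]
    refine sum_congr rfl fun m _ => ?_
    split_ifs with hm
    · rw [e4 m hm, e5]; ring
    · ring
  rw [e6]
  split_ifs at h ⊢ with hk
  · rw [e4 k hk] at h
    linear_combination h
  · linear_combination h

lemma mem_of_coeff_mul_ne_zero {P Q R : Set (ℕ →₀ ℕ)} {f g : MvPowerSeries ℕ ℝ}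
    (hf : ∀ d, coeff d f ≠ 0 → d ∈ P) (hg : ∀ d, coeff d g ≠ 0 → d ∈ Q)
    (hR : ∀ x ∈ P, ∀ y ∈ Q, x + y ∈ R) (d : ℕ →₀ ℕ) (hd : coeff d (f * g) ≠ 0) : d ∈ R := by
  classical
  rw [coeff_mul] at hd
  obtain ⟨x, hx, h⟩ := exists_ne_zero_of_sum_ne_zero hd
  rw [← mem_antidiagonal.1 hx]
  exact hR _ (hf _ (left_ne_zero_of_mul h)) _ (hg _ (right_ne_zero_of_mul h))

lemma mem_of_coeff_seriesComp_ne_zero {P : Set (ℕ →₀ ℕ)} {W : MvPowerSeries ℕ ℝ}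
    (hW : ∀ d, coeff d W ≠ 0 → d ∈ P) (hP : ∀ x ∈ P, ∀ y ∈ P, x + y ∈ P) (g : ℕ → ℝ)
    (d : ℕ →₀ ℕ) (hd : coeff d (seriesComp g W) ≠ 0) : d = 0 ∨ d ∈ P := by
  classical
  rw [coeff_seriesComp] at hd
  obtain ⟨ℓ, -, h⟩ := exists_ne_zero_of_sum_ne_zero hd
  replace h := right_ne_zero_of_mul h
  rcases ℓ with _ | ℓ
  · left
    by_contra h0
    simp [coeff_one, h0] at h
  · right
    have key : ∀ n : ℕ, ∀ d, coeff d (W ^ (n + 1)) ≠ 0 → d ∈ P := by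
      intro n
      induction n with
      | zero => simpa using hW
      | succ n ih =>
        rw [pow_succ]
        exact mem_of_coeff_mul_ne_zero ih hW hP
    exact key ℓ d h

lemma coeff_clusterSeries_ne_zero (b : ℕ → ℝ) (m : ℕ) (d : ℕ →₀ ℕ)
    (hd : coeff d (clusterSeries b m) ≠ 0) :
    (∀ n, d (n + 1) ≤ d n) ∧ 1 ≤ d m ∧ ∀ j, m < j → d j = 0 := by
  classical
  induction m generalizing d with
  | zero =>
    have h : d = Finsupp.single 0 1 := by
      by_contra h
      simp [clusterSeries, coeff_X, h] at hd
    subst h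
    simp [Finsupp.single_apply]
    intro j hj
    omega
  | succ m ih =>
    rw [clusterSeries, X, coeff_monomial_mul] at hd
    split_ifs at hd with hle
    · rw [one_mul] at hd
      set e := d - Finsupp.single (m + 1) 1 with he
      have hde : d = e + Finsupp.single (m + 1) 1 := (tsub_add_cancel_of_le hle).symm
      have h0 : e ≠ 0 := by
        intro h0
        rw [h0, map_sub, coeff_zero_eq_constantCoeff_apply, coeff_zero_eq_constantCoeff_apply,
          constantCoeff_seriesComp] at hd
        simp [risingCoeff] at hd
      have h1 : coeff e (seriesComp (risingCoeff (-(b (m + 1) / b m))) (clusterSeries b m)) ≠ 0 := by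
        intro h1
        rw [map_sub, h1, coeff_one, if_neg h0] at hd
        simp at hd
      have h2 := (mem_of_coeff_seriesComp_ne_zero
        (P := {d | (∀ n, d (n + 1) ≤ d n) ∧ 1 ≤ d m ∧ ∀ j, m < j → d j = 0}) ih
        (fun x hx y hy => ⟨fun n => add_le_add (hx.1 n) (hy.1 n),
          le_add_right hx.2.1, fun j hj => by
            simp [hx.2.2 j hj, hy.2.2 j hj]⟩) _ e h1).resolve_left h0
      obtain ⟨h3, h4, h5⟩ := h2
      rw [hde]
      refine ⟨fun n => ?_, ?_, fun j hj => ?_⟩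
      · have := h3 n
        simp only [Finsupp.add_apply, Finsupp.single_apply]
        rcases eq_or_ne n m with rfl | hn
        · rw [h5 (n + 1) (by omega)]
          simp
          omega
        · split_ifs <;> omega
      · simp
      · simp only [Finsupp.add_apply, Finsupp.single_apply]
        rw [h5 j (by omega), if_neg (by omega), add_zero]
    · exact absurd rfl hd

lemma coeff_degreeSeries_ne_zero (b : ℕ → ℝ) (a : ℝ) (n : ℕ) (d : ℕ →₀ ℕ)
    (hd : coeff d (degreeSeries b a n) ≠ 0) (j : ℕ) : d (j + 1) ≤ d j := by
  classical
  induction n generalizing d j with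
  | zero =>
    have h : d = 0 := by
      by_contra h
      simp [degreeSeries, coeff_one, h] at hd
    simp [h]
  | succ n ih =>
    rw [degreeSeries, prod_range_succ, ← degreeSeries] at hd
    refine mem_of_coeff_mul_ne_zero (P := {d | ∀ j, d (j + 1) ≤ d j})
      (Q := {d | ∀ j, d (j + 1) ≤ d j}) (R := {d | ∀ j, d (j + 1) ≤ d j}) ih ?_
      (fun x hx y hy j => add_le_add (hx j) (hy j)) d hd j
    intro e he
    rcases mem_of_coeff_seriesComp_ne_zero
        (P := {d | (∀ n, d (n + 1) ≤ d n) ∧ 1 ≤ d n ∧ ∀ j, n < j → d j = 0})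
        (coeff_clusterSeries_ne_zero b n)
        (fun x hx y hy => ⟨fun n => add_le_add (hx.1 n) (hy.1 n),
          le_add_right hx.2.1, fun j hj => by
            simp [hx.2.2 j hj, hy.2.2 j hj]⟩) _ e he with h | h
    · simp [h]
    · exact h.1

/-- Scaling of the variable `X_0` by the factor `c`. -/
def scaleHead (c : ℝ) : MvPowerSeries ℕ ℝ →+* MvPowerSeries ℕ ℝ :=
  rescale fun j => if j = 0 then c else 1

lemma coeff_scaleHead (c : ℝ) (f : MvPowerSeries ℕ ℝ) (d : ℕ →₀ ℕ) :
    coeff d (scaleHead c f) = c ^ d 0 * coeff d f := by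
  rw [scaleHead, coeff_rescale]
  congr 1
  rw [Finsupp.prod, prod_eq_single 0]
  · simp
  · intro j _ hj
    simp [hj]
  · intro h
    simp [Finsupp.notMem_support_iff.1 h]

lemma scaleHead_seriesComp (c : ℝ) (g : ℕ → ℝ) (W : MvPowerSeries ℕ ℝ) :
    scaleHead c (seriesComp g W) = seriesComp g (scaleHead c W) := by
  ext d
  simp only [coeff_scaleHead, coeff_seriesComp, ← map_pow, mul_sum]
  exact sum_congr rfl fun ℓ _ => by ring

lemma scaleHead_X_zero (c : ℝ) : scaleHead c (X 0) = X 0 * C c := by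
  classical
  ext d
  rw [coeff_scaleHead, mul_comm (X 0), coeff_C_mul, coeff_X]
  split_ifs with h
  · simp [h]
  · simp

lemma scaleHead_X_succ (c : ℝ) (m : ℕ) : scaleHead c (X (m + 1)) = X (m + 1) := by
  classical
  ext d
  rw [coeff_scaleHead, coeff_X]
  split_ifs with h
  · simp [h]
  · simp

end SeriesAlgebra

section GeneratingSeries

open MvPowerSeries

/-- The measure of each level set of the map `e` is the corresponding coefficient of `F`. -/
def HasGenSeries {α : Type*} [MeasurableSpace α] (e : α → ℕ →₀ ℕ) (μ : Measure α)
    (F : MvPowerSeries ℕ ℝ) : Prop :=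
  ∀ d, 0 ≤ coeff d F ∧ μ (e ⁻¹' {d}) = ENNReal.ofReal (coeff d F)

lemma HasGenSeries.sigmaFinite {α : Type*} [MeasurableSpace α] {e : α → ℕ →₀ ℕ} {μ : Measure α}
    {F : MvPowerSeries ℕ ℝ} (h : HasGenSeries e μ F) : SigmaFinite μ := by
  refine Measure.sigmaFinite_of_countable (S := Set.range fun d => e ⁻¹' {d})
    (Set.countable_range _) ?_ ?_
  · rintro _ ⟨d, rfl⟩
    simp only [(h d).2, ENNReal.ofReal_lt_top]
  · refine Set.eq_univ_of_forall fun x => ?_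
    exact Set.mem_sUnion.2 ⟨_, ⟨e x, rfl⟩, rfl⟩

lemma coeff_mul_nonneg {F G : MvPowerSeries ℕ ℝ} (hF : ∀ d, 0 ≤ coeff d F)
    (hG : ∀ d, 0 ≤ coeff d G) (d : ℕ →₀ ℕ) : 0 ≤ coeff d (F * G) := by
  classical
  rw [coeff_mul]
  exact sum_nonneg fun p _ => mul_nonneg (hF _) (hG _)

lemma HasGenSeries.prod {α β : Type*} [MeasurableSpace α] [MeasurableSpace β]
    [DiscreteMeasurableSpace α] [DiscreteMeasurableSpace β]
    {e : α → ℕ →₀ ℕ} {e' : β → ℕ →₀ ℕ} {μ : Measure α} {ν : Measure β}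
    {F G : MvPowerSeries ℕ ℝ} (hF : HasGenSeries e μ F) (hG : HasGenSeries e' ν G) :
    HasGenSeries (fun p : α × β => e p.1 + e' p.2) (μ.prod ν) (F * G) := by
  classical
  intro d
  refine ⟨coeff_mul_nonneg (fun d => (hF d).1) (fun d => (hG d).1) d, ?_⟩
  have := hG.sigmaFinite
  have hset : (fun p : α × β => e p.1 + e' p.2) ⁻¹' {d}
      = ⋃ q ∈ antidiagonal d, (e ⁻¹' {q.1}) ×ˢ (e' ⁻¹' {q.2}) := by
    ext p
    simp only [Set.mem_preimage, Set.mem_singleton_iff, Set.mem_iUnion, Set.mem_prod, exists_prop,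
      HasAntidiagonal.mem_antidiagonal]
    constructor
    · exact fun h => ⟨(e p.1, e' p.2), h, rfl, rfl⟩
    · rintro ⟨q, h, h1, h2⟩
      rw [h1, h2, h]
  rw [hset, measure_biUnion_finset, coeff_mul, ENNReal.ofReal_sum_of_nonneg]
  · refine sum_congr rfl fun q _ => ?_
    rw [Measure.prod_prod, (hF _).2, (hG _).2, ENNReal.ofReal_mul (hF _).1]
  · exact fun q _ => mul_nonneg (hF _).1 (hG _).1
  · intro q _ q' _ hqq
    refine Set.disjoint_left.2 fun p hp hp' => hqq ?_
    exact Prod.ext (hp.1.symm.trans hp'.1) (hp.2.symm.trans hp'.2)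
  · exact fun q _ => (MeasurableSet.of_discrete).prod MeasurableSet.of_discrete

lemma HasGenSeries.map {α β : Type*} [MeasurableSpace α] [MeasurableSpace β]
    [DiscreteMeasurableSpace β] {e : α → ℕ →₀ ℕ} {e' : β → ℕ →₀ ℕ} {μ : Measure α}
    {F : MvPowerSeries ℕ ℝ} (hF : HasGenSeries e μ F) {f : α → β} (hf : Measurable f)
    (he : ∀ x, e' (f x) = e x) : HasGenSeries e' (μ.map f) F := by
  intro d
  rw [Measure.map_apply hf MeasurableSet.of_discrete, ← (hF d).2]
  refine ⟨(hF d).1, congrArg _ ?_⟩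
  ext x
  simp [he]

/-- The exponent vector with the entries of `v` in the first `m` places. -/
def vecExp {m : ℕ} (v : Fin m → ℕ) : ℕ →₀ ℕ := ∑ j : Fin m, Finsupp.single (j : ℕ) (v j)

lemma vecExp_add {m : ℕ} (v w : Fin m → ℕ) : vecExp (v + w) = vecExp v + vecExp w := by
  simp [vecExp, sum_add_distrib]

lemma vecExp_snoc {m : ℕ} (v : Fin m → ℕ) (ℓ : ℕ) :
    vecExp (Fin.snoc v ℓ : Fin (m + 1) → ℕ) = Finsupp.single m ℓ + vecExp v := by
  rw [vecExp, Fin.sum_univ_castSucc, add_comm]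
  simp [vecExp]

lemma hasGenSeries_dirac_zero (m : ℕ) :
    HasGenSeries (vecExp (m := m)) (Measure.dirac 0) 1 := by
  classical
  intro d
  have h0 : vecExp (0 : Fin m → ℕ) = 0 := by simp [vecExp]
  rw [Measure.dirac_apply' _ MeasurableSet.of_discrete, coeff_one]
  by_cases h : d = 0
  · simp [h, h0]
  · simp [h, h0, Ne.symm h]

lemma HasGenSeries.convPow {m : ℕ} {ν : Measure (Fin m → ℕ)} {F : MvPowerSeries ℕ ℝ}
    (hF : HasGenSeries vecExp ν F) (ℓ : ℕ) : HasGenSeries vecExp (convPow ν ℓ) (F ^ ℓ) := by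
  induction ℓ with
  | zero => simpa [_root_.convPow] using hasGenSeries_dirac_zero m
  | succ ℓ ih =>
    rw [pow_succ', _root_.convPow]
    exact (hF.prod ih).map (Measurable.of_discrete) fun p => vecExp_add _ _

lemma HasGenSeries.compound {m : ℕ} {ν : Measure (Fin m → ℕ)} {F : MvPowerSeries ℕ ℝ}
    (hF : HasGenSeries vecExp ν F) {w : ℕ → ℝ} (hw : ∀ ℓ, 0 ≤ w ℓ)
    {β : Type*} [MeasurableSpace β] [DiscreteMeasurableSpace β] {e : β → ℕ →₀ ℕ}
    (h : ℕ → (Fin m → ℕ) → β) (he : ∀ ℓ v, e (h ℓ v) = Finsupp.single m ℓ + vecExp v) :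
    HasGenSeries e ((natMeasure w).bind fun ℓ => (_root_.convPow ν ℓ).map (h ℓ))
      (seriesComp w (X m * F)) := by
  have hpow : ∀ ℓ d, coeff d ((X m * F) ^ ℓ)
      = if Finsupp.single m ℓ ≤ d then coeff (d - Finsupp.single m ℓ) (F ^ ℓ) else 0 := by
    intro ℓ d
    rw [mul_pow, X_pow_eq, coeff_monomial_mul]
    simp
  have hnn : ∀ ℓ d, 0 ≤ coeff d ((X m * F) ^ ℓ) := by
    intro ℓ d
    rw [hpow]
    split_ifs
    · exact (hF.convPow ℓ _).1
    · exact le_rfl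
  have hmeas : ∀ ℓ d, (_root_.convPow ν ℓ).map (h ℓ) (e ⁻¹' {d})
      = ENNReal.ofReal (coeff d ((X m * F) ^ ℓ)) := by
    intro ℓ d
    rw [Measure.map_apply Measurable.of_discrete MeasurableSet.of_discrete, hpow]
    split_ifs with hle
    · rw [← (hF.convPow ℓ _).2]
      congr 1
      ext v
      simp only [Set.mem_preimage, Set.mem_singleton_iff, he]
      rw [eq_tsub_iff_add_eq_of_le hle, add_comm]
    · have hempty : h ℓ ⁻¹' (e ⁻¹' {d}) = ∅ := by
        refine Set.eq_empty_of_forall_notMem fun v hv => hle ?_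
        simp only [Set.mem_preimage, Set.mem_singleton_iff, he] at hv
        rw [← hv]
        exact le_self_add
      rw [hempty, measure_empty, ENNReal.ofReal_zero]
  intro d
  rw [coeff_seriesComp]
  refine ⟨sum_nonneg fun ℓ _ => mul_nonneg (hw ℓ) (hnn ℓ d), ?_⟩
  rw [Measure.bind_apply MeasurableSet.of_discrete (Measurable.of_discrete).aemeasurable,
    natMeasure, lintegral_sum_measure]
  simp only [lintegral_smul_measure, lintegral_dirac, hmeas, smul_eq_mul]
  rw [tsum_eq_sum (s := range (d.degree + 1)), ENNReal.ofReal_sum_of_nonneg]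
  · exact sum_congr rfl fun ℓ _ => (ENNReal.ofReal_mul (hw ℓ)).symm
  · exact fun ℓ _ => mul_nonneg (hw ℓ) (hnn ℓ d)
  · intro ℓ hℓ
    rw [coeff_pow_eq_zero_of_degree_lt (by simp) (by simpa using hℓ), ENNReal.ofReal_zero,
      mul_zero]

lemma coeff_prod_nonneg {ι : Type*} (s : Finset ι) {F : ι → MvPowerSeries ℕ ℝ}
    (hF : ∀ i d, 0 ≤ coeff d (F i)) (d : ℕ →₀ ℕ) : 0 ≤ coeff d (∏ i ∈ s, F i) := by
  classical
  rw [coeff_prod]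
  exact sum_nonneg fun l _ => prod_nonneg fun i _ => hF _ _

lemma HasGenSeries.pi {ι : Type*} [Fintype ι] {α : ι → Type*} [∀ i, MeasurableSpace (α i)]
    [∀ i, DiscreteMeasurableSpace (α i)] {e : ∀ i, α i → ℕ →₀ ℕ} {μ : ∀ i, Measure (α i)}
    {F : ι → MvPowerSeries ℕ ℝ} (hF : ∀ i, HasGenSeries (e i) (μ i) (F i)) :
    HasGenSeries (fun x : ∀ i, α i => ∑ i, e i (x i)) (Measure.pi μ) (∏ i, F i) := by
  classical
  intro d
  refine ⟨coeff_prod_nonneg _ (fun i d => (hF i d).1) d, ?_⟩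
  have := fun i => (hF i).sigmaFinite
  have hset : (fun x : ∀ i, α i => ∑ i, e i (x i)) ⁻¹' {d}
      = ⋃ l ∈ finsuppAntidiag univ d, Set.univ.pi fun i => e i ⁻¹' {l i} := by
    ext x
    simp only [Set.mem_preimage, Set.mem_singleton_iff, Set.mem_iUnion, Set.mem_univ_pi,
      exists_prop, mem_finsuppAntidiag, subset_univ, and_true]
    constructor
    · exact fun h => ⟨Finsupp.equivFunOnFinite.symm fun i => e i (x i), by simpa using h,
        fun i => rfl⟩
    · rintro ⟨l, h, h1⟩
      rw [← h]
      exact sum_congr rfl fun i _ => h1 i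
  rw [hset, measure_biUnion_finset, coeff_prod, ENNReal.ofReal_sum_of_nonneg]
  · refine sum_congr rfl fun l _ => ?_
    rw [Measure.pi_pi, ENNReal.ofReal_prod_of_nonneg fun i _ => (hF i _).1]
    exact prod_congr rfl fun i _ => (hF i _).2
  · exact fun l _ => prod_nonneg fun i _ => (hF i _).1
  · intro l _ l' _ hll
    refine Set.disjoint_left.2 fun x hx hx' => hll ?_
    ext1 i
    exact (hx i trivial).symm.trans (hx' i trivial)
  · exact fun l _ => MeasurableSet.univ_pi fun i => MeasurableSet.of_discrete

end GeneratingSeries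

section Weights

lemma risingCoeff_eq_Gamma {r : ℝ} (hr : 0 < r) (ℓ : ℕ) :
    Real.Gamma ((ℓ : ℝ) + r) / ((ℓ.factorial : ℝ) * Real.Gamma r) = risingCoeff r ℓ := by
  have hG := (Real.Gamma_pos_of_pos hr).ne'
  induction ℓ with
  | zero => simp [risingCoeff, hG]
  | succ ℓ ih =>
    have h1 : ((ℓ + 1 : ℕ) : ℝ) + r = (ℓ + r) + 1 := by push_cast; ring
    have h2 : (ℓ.factorial : ℝ) ≠ 0 := by positivity
    have h3 : (ℓ : ℝ) + 1 ≠ 0 := by positivity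
    rw [h1, Real.Gamma_add_one (by positivity), risingCoeff, ← ih, Nat.factorial_succ]
    push_cast
    field_simp
    ring

lemma risingCoeff_neg_eq_Gamma {κ : ℝ} (hκ : κ < 1) (ℓ : ℕ) :
    κ * Real.Gamma (((ℓ + 1 : ℕ) : ℝ) - κ) / (((ℓ + 1).factorial : ℝ) * Real.Gamma (1 - κ))
      = -risingCoeff (-κ) (ℓ + 1) := by
  have hG := (Real.Gamma_pos_of_pos (sub_pos.2 hκ)).ne'
  induction ℓ with
  | zero => simp [risingCoeff, hG]
  | succ ℓ ih =>
    have h1 : ((ℓ + 1 + 1 : ℕ) : ℝ) - κ = (((ℓ + 1 : ℕ) : ℝ) - κ) + 1 := by push_cast; ring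
    have h2 : ((ℓ + 1).factorial : ℝ) ≠ 0 := by positivity
    have h3 : (ℓ : ℝ) + 1 + 1 ≠ 0 := by positivity
    have h4 : ((ℓ + 1 : ℕ) : ℝ) - κ ≠ 0 := by
      push_cast
      have : (0 : ℝ) ≤ ℓ := by positivity
      linarith
    rw [h1, Real.Gamma_add_one h4, show risingCoeff (-κ) (ℓ + 1 + 1)
      = risingCoeff (-κ) (ℓ + 1) * (-κ + ((ℓ + 1 : ℕ) : ℝ)) / (((ℓ + 1 : ℕ) : ℝ) + 1) from rfl,
      ← neg_eq_iff_eq_neg.2 ih, Nat.factorial_succ (ℓ + 1)]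
    push_cast
    field_simp
    ring

lemma nbWeight_eq {r : ℝ} (hr : 0 < r) (a : ℝ) (ℓ : ℕ) :
    nbWeight r a ℓ = a ^ r * (risingCoeff r ℓ * (1 - a) ^ ℓ) := by
  rw [nbWeight, risingCoeff_eq_Gamma hr]
  ring

lemma nbWeight_nonneg {r a : ℝ} (hr : 0 < r) (ha : 0 ≤ a) (ha1 : a ≤ 1) (ℓ : ℕ) :
    0 ≤ nbWeight r a ℓ := by
  have h1 := Real.Gamma_pos_of_pos hr
  have h2 : 0 < Real.Gamma (ℓ + r) := Real.Gamma_pos_of_pos (by positivity)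
  have h3 : 0 ≤ 1 - a := by linarith
  unfold nbWeight
  positivity

lemma tnbWeight_nonneg {κ a : ℝ} (hκ : 0 < κ) (hκ1 : κ < 1) (ha : 0 ≤ a) (ha1 : a ≤ 1) (ℓ : ℕ) :
    0 ≤ tnbWeight κ a ℓ := by
  unfold tnbWeight
  split_ifs with h
  · exact le_rfl
  · have h0 : (1 : ℝ) ≤ ℓ := by exact_mod_cast Nat.one_le_iff_ne_zero.2 h
    have h1 := Real.Gamma_pos_of_pos (sub_pos.2 hκ1)
    have h2 : 0 < Real.Gamma (ℓ - κ) := Real.Gamma_pos_of_pos (by linarith)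
    have h3 : 0 ≤ 1 - a := by linarith
    have h4 : 0 ≤ 1 - a ^ κ := sub_nonneg.2 (Real.rpow_le_one ha ha1 hκ.le)
    positivity

end Weights

section Laws

open MvPowerSeries

lemma seriesComp_mul_pow (g : ℕ → ℝ) (c y : ℝ) (W : MvPowerSeries ℕ ℝ) :
    seriesComp (fun ℓ => c * (g ℓ * y ^ ℓ)) W = C c * seriesComp g (C y * W) := by
  ext d
  simp only [coeff_C_mul, coeff_seriesComp, mul_sum, mul_pow, ← map_pow]
  exact sum_congr rfl fun ℓ _ => by ring

lemma seriesComp_tnbWeight {κ : ℝ} (hκ1 : κ < 1) (a : ℝ) (W : MvPowerSeries ℕ ℝ) :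
    seriesComp (tnbWeight κ a) W
      = C (1 - a ^ κ)⁻¹ * (1 - seriesComp (risingCoeff (-κ)) (C (1 - a) * W)) := by
  ext d
  rw [coeff_C_mul, map_sub (coeff d)]
  simp only [coeff_C_mul, coeff_seriesComp, mul_pow, ← map_pow]
  rw [sum_range_succ', sum_range_succ']
  simp only [pow_zero, tnbWeight, if_true, Nat.add_eq_zero_iff, one_ne_zero, and_false, if_false,
    risingCoeff_neg_eq_Gamma hκ1, zero_mul, add_zero]
  have : risingCoeff (-κ) 0 = 1 := rfl
  rw [this, one_mul, one_mul, sub_add_cancel_right, ← sum_neg_distrib, mul_sum]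
  exact sum_congr rfl fun ℓ _ => by ring

lemma bcoef_pos {k : ℕ} {δ : ℝ} (hδ : -1 < δ) {m : ℕ} (hm : m ≤ k) : 0 < bcoef k δ m := by
  have h : (0 : ℝ) ≤ (k : ℝ) - m := sub_nonneg.2 (by exact_mod_cast hm)
  unfold bcoef
  nlinarith [mul_nonneg h (by linarith : (0 : ℝ) ≤ 1 + δ)]

lemma bcoef_succ (k : ℕ) (δ : ℝ) (m : ℕ) : bcoef k δ (m + 1) = bcoef k δ m - (1 + δ) := by
  unfold bcoef
  push_cast
  ring

lemma bcoef_self (k : ℕ) (δ : ℝ) : bcoef k δ k = 1 := by simp [bcoef]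

lemma rpow_neg_lt_one {z x : ℝ} (hz : 1 < z) (hx : 0 < x) : z ^ (-x) < 1 :=
  Real.rpow_lt_one_of_one_lt_of_neg hz (neg_neg_of_pos hx)

lemma exists_hasGenSeries_vecLaw {k : ℕ} {δ : ℝ} (hδ : -1 < δ) {z : ℝ} (hz : 1 < z) {m : ℕ}
    (hm : m ≤ k) :
    ∃ F, HasGenSeries vecExp (vecLaw k δ z m) F ∧
      C (1 - z ^ (-(bcoef k δ m / bcoef k δ 0))) * (X m * F)
        = scaleHead (1 - z⁻¹) (clusterSeries (bcoef k δ) m) := by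
  have hb0 := bcoef_pos hδ (Nat.zero_le k)
  have hz0 : 0 < z := by linarith
  induction m with
  | zero =>
    refine ⟨1, hasGenSeries_dirac_zero 0, ?_⟩
    rw [clusterSeries, scaleHead_X_zero, div_self hb0.ne', Real.rpow_neg_one]
    ring
  | succ m ih =>
    obtain ⟨F, hF, hFc⟩ := ih (by omega)
    have hbm := bcoef_pos hδ (show m ≤ k by omega)
    have hbm1 := bcoef_pos hδ hm
    have hκ : 0 < bcoef k δ (m + 1) / bcoef k δ m := div_pos hbm1 hbm
    have hκ1 : bcoef k δ (m + 1) / bcoef k δ m < 1 := by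
      rw [div_lt_one hbm, bcoef_succ]
      linarith
    refine ⟨_, hF.compound (tnbWeight_nonneg hκ hκ1 (by positivity)
      (rpow_neg_lt_one hz (div_pos hbm hb0)).le) _ fun ℓ v => vecExp_snoc v ℓ, ?_⟩
    have hpow : (z ^ (-(bcoef k δ m / bcoef k δ 0))) ^ (bcoef k δ (m + 1) / bcoef k δ m)
        = z ^ (-(bcoef k δ (m + 1) / bcoef k δ 0)) := by
      rw [← Real.rpow_mul hz0.le]
      congr 1
      field_simp
    have hy : 1 - z ^ (-(bcoef k δ (m + 1) / bcoef k δ 0)) ≠ 0 :=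
      (sub_pos.2 (rpow_neg_lt_one hz (div_pos hbm1 hb0))).ne'
    rw [seriesComp_tnbWeight hκ1, hpow, hFc, clusterSeries, map_mul (scaleHead _),
      map_sub (scaleHead _), map_one (scaleHead _), scaleHead_X_succ, scaleHead_seriesComp,
      mul_left_comm, ← mul_assoc (C _), ← map_mul, mul_inv_cancel₀ hy, map_one, one_mul]

lemma hasGenSeries_pairLaw {k : ℕ} {δ : ℝ} (hδ : -1 < δ) {z : ℝ} (hz : 1 < z) {m : ℕ}
    (hm : m ≤ k) :
    HasGenSeries (fun x : ℕ × (Fin m → ℕ) => Finsupp.single m x.1 + vecExp x.2)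
      (pairLaw k δ z m)
      (C (z ^ (-((1 + δ) / bcoef k δ 0))) * scaleHead (1 - z⁻¹)
        (seriesComp (risingCoeff ((1 + δ) / bcoef k δ m)) (clusterSeries (bcoef k δ) m))) := by
  obtain ⟨F, hF, hFc⟩ := exists_hasGenSeries_vecLaw hδ hz hm
  have hb0 := bcoef_pos hδ (Nat.zero_le k)
  have hz0 : 0 < z := by linarith
  have hbm := bcoef_pos hδ hm
  have hr : 0 < (1 + δ) / bcoef k δ m := div_pos (by linarith) hbm
  have h := hF.compound (nbWeight_nonneg hr (a := z ^ (-(bcoef k δ m / bcoef k δ 0)))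
    (by positivity) (rpow_neg_lt_one hz (div_pos hbm hb0)).le) (β := ℕ × (Fin m → ℕ))
    (e := fun x => Finsupp.single m x.1 + vecExp x.2) (fun t v => (t, v)) fun ℓ v => rfl
  have hpow : (z ^ (-(bcoef k δ m / bcoef k δ 0))) ^ ((1 + δ) / bcoef k δ m)
      = z ^ (-((1 + δ) / bcoef k δ 0)) := by
    rw [← Real.rpow_mul hz0.le]
    congr 1
    field_simp
  rw [funext (nbWeight_eq hr _), seriesComp_mul_pow, hpow, hFc, ← scaleHead_seriesComp] at h
  simpa only [pairLaw, funext (nbWeight_eq hr _), hpow] using h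

lemma vecExp_apply {m : ℕ} (v : Fin m → ℕ) (j : ℕ) :
    vecExp v j = if h : j < m then v ⟨j, h⟩ else 0 := by
  rw [vecExp, Finsupp.finsetSum_apply]
  split_ifs with h
  · rw [sum_eq_single ⟨j, h⟩]
    · simp
    · intro i _ hi
      rw [Finsupp.single_apply, if_neg]
      exact fun h' => hi (Fin.ext h')
    · simp
  · refine sum_eq_zero fun i _ => ?_
    rw [Finsupp.single_apply, if_neg]
    have := i.2
    omega

/-- The degree vector whose excess over the minimal vector `(k + 1, …, 1)` is `e`. -/
def toIdx (k : ℕ) (e : ℕ →₀ ℕ) : Fin (k + 1) → ℕ := fun j => (k - (j : ℕ) + 1) + e j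

lemma assembleD_eq_toIdx (k : ℕ) (x : ∀ m : Fin (k + 1), ℕ × (Fin (m : ℕ) → ℕ)) :
    assembleD k x
      = toIdx k (∑ m : Fin (k + 1), (Finsupp.single (m : ℕ) (x m).1 + vecExp (x m).2)) := by
  funext i
  simp only [assembleD, toIdx, sum_add_distrib, Finsupp.add_apply, Finsupp.finsetSum_apply,
    vecExp_apply, add_assoc]
  congr 3
  rw [sum_eq_single i]
  · simp
  · intro j _ hj
    rw [Finsupp.single_apply, if_neg]
    exact fun h => hj (Fin.ext h)
  · simp

lemma Dlaw_toIdx {k : ℕ} {δ : ℝ} (hδ : -1 < δ) {z : ℝ} (hz : 1 < z) {e : ℕ →₀ ℕ}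
    (he : ∀ j, k < j → e j = 0) :
    (Dlaw k δ z {toIdx k e}).toReal
      = (z ^ (-((1 + δ) / bcoef k δ 0))) ^ (k + 1) * ((1 - z⁻¹) ^ e 0 *
        coeff e (degreeSeries (bcoef k δ) (1 + δ) (k + 1))) := by
  have h := HasGenSeries.pi fun m : Fin (k + 1) =>
    hasGenSeries_pairLaw hδ hz (Nat.le_of_lt_succ m.2)
  have hset : assembleD k ⁻¹' {toIdx k e}
      = (fun x : ∀ m : Fin (k + 1), ℕ × (Fin (m : ℕ) → ℕ) =>
          ∑ m : Fin (k + 1), (Finsupp.single (m : ℕ) (x m).1 + vecExp (x m).2)) ⁻¹' {e} := by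
    ext x
    simp only [Set.mem_preimage, Set.mem_singleton_iff, assembleD_eq_toIdx]
    refine ⟨fun h => ?_, fun h => by rw [h]⟩
    ext j
    rcases lt_or_ge k j with hj | hj
    · rw [he j hj, Finsupp.finsetSum_apply]
      refine sum_eq_zero fun m _ => ?_
      have := m.2
      rw [Finsupp.add_apply, vecExp_apply, dif_neg (by omega), Finsupp.single_apply,
        if_neg (by omega), add_zero]
    · have := congrFun h ⟨j, Nat.lt_succ_of_le hj⟩
      simpa [toIdx] using this
  rw [Dlaw, Measure.map_apply Measurable.of_discrete MeasurableSet.of_discrete, hset, jointLaw,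
    (h e).2, ENNReal.toReal_ofReal (h e).1, prod_mul_distrib, prod_const, card_univ,
    Fintype.card_fin, ← map_pow, coeff_C_mul, ← map_prod, coeff_scaleHead,
    Fin.prod_univ_eq_prod_range
      (fun m => seriesComp (risingCoeff ((1 + δ) / bcoef k δ m)) (clusterSeries (bcoef k δ) m))]
  rfl

end Laws

section BetaIntegral

lemma integrableOn_pareto_mul_pow {α : ℝ} (hα : 0 < α) (n : ℕ) :
    IntegrableOn (fun z : ℝ => z ^ (-(1 + α)) * (1 - z⁻¹) ^ n) (Set.Ioi 1) := by
  have h := integrableOn_Ioi_rpow_of_lt (a := -(1 + α)) (c := 1) (by linarith) one_pos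
  refine Integrable.mono' h (Measurable.aestronglyMeasurable (by fun_prop)) ?_
  refine (ae_restrict_mem measurableSet_Ioi).mono fun z hz => ?_
  have hz : 1 < z := hz
  have h1 : 0 ≤ 1 - z⁻¹ := sub_nonneg.2 (inv_le_one_of_one_le₀ hz.le)
  have h2 : 1 - z⁻¹ ≤ 1 := by
    have : 0 < z⁻¹ := by positivity
    linarith
  rw [Real.norm_of_nonneg (by positivity)]
  exact mul_le_of_le_one_right (by positivity) (pow_le_one₀ h1 h2)

lemma integral_pareto {α : ℝ} (hα : 0 < α) :
    ∫ z in Set.Ioi (1 : ℝ), z ^ (-(1 + α)) * (1 - z⁻¹) ^ 0 = α⁻¹ := by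
  simp only [pow_zero, mul_one]
  rw [integral_Ioi_rpow_of_lt (by linarith) one_pos, Real.one_rpow,
    show -(1 + α) + 1 = -α by ring]
  field_simp

lemma integral_pareto_mul_pow_succ {α : ℝ} (hα : 0 < α) (n : ℕ) :
    (α + n + 1) * ∫ z in Set.Ioi (1 : ℝ), z ^ (-(1 + α)) * (1 - z⁻¹) ^ (n + 1)
      = (n + 1) * ∫ z in Set.Ioi (1 : ℝ), z ^ (-(1 + α)) * (1 - z⁻¹) ^ n := by
  have hi1 := (integrableOn_pareto_mul_pow hα (n + 1)).const_mul (α + n + 1)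
  have hi0 := (integrableOn_pareto_mul_pow hα n).const_mul ((n : ℝ) + 1)
  have hderiv : ∀ z ∈ Set.Ici (1 : ℝ), HasDerivAt (fun z : ℝ => z ^ (-α) * (1 - z⁻¹) ^ (n + 1))
      ((n + 1) * (z ^ (-(1 + α)) * (1 - z⁻¹) ^ n)
        - (α + n + 1) * (z ^ (-(1 + α)) * (1 - z⁻¹) ^ (n + 1))) z := by
    intro z hz
    have hz0 : 0 < z := lt_of_lt_of_le one_pos hz
    have h1 := Real.hasDerivAt_rpow_const (x := z) (p := -α) (Or.inl hz0.ne')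
    have h2 := (((hasDerivAt_inv hz0.ne').const_sub 1).pow (n + 1))
    refine (h1.mul h2).congr_deriv ?_
    have e1 : z ^ (-α - 1) = z ^ (-(1 + α)) := by congr 1; ring
    have e2 : z ^ (-α) = z ^ (-(1 + α)) * z := by
      rw [← Real.rpow_add_one hz0.ne']; congr 1; ring
    rw [e1, e2]
    simp only [add_tsub_cancel_right, Pi.pow_apply, pow_succ (1 - z⁻¹) n]
    generalize (1 - z⁻¹) ^ n = y
    push_cast
    field_simp
    ring
  have hlim : Tendsto (fun z : ℝ => z ^ (-α) * (1 - z⁻¹) ^ (n + 1)) atTop (nhds 0) := by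
    have h1 := tendsto_rpow_neg_atTop hα
    have h2 : Tendsto (fun z : ℝ => (1 - z⁻¹) ^ (n + 1)) atTop (nhds ((1 - 0) ^ (n + 1))) :=
      (tendsto_inv_atTop_zero.const_sub 1).pow (n + 1)
    simpa using h1.mul h2
  have h := integral_Ioi_of_hasDerivAt_of_tendsto' hderiv (hi0.sub hi1) hlim
  rw [integral_sub hi0 hi1, integral_const_mul, integral_const_mul] at h
  simp only [inv_one, sub_self, ne_eq, Nat.add_eq_zero_iff, one_ne_zero, and_false,
    not_false_eq_true, zero_pow, mul_zero] at h
  linarith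

end BetaIntegral

section Recursion

open MvPowerSeries

lemma validIdx_toIdx (k : ℕ) (e : ℕ →₀ ℕ) :
    ValidIdx k (toIdx k e) ↔ ∀ j < k, e (j + 1) ≤ e j := by
  rw [ValidIdx, Fin.strictAnti_iff_succ_lt]
  simp only [toIdx, Fin.val_last, Fin.val_succ, Fin.val_castSucc]
  refine ⟨fun h j hj => ?_, fun h => ⟨by omega, fun j => ?_⟩⟩
  · have := h.2 ⟨j, hj⟩
    simp only at this
    omega
  · have := h j j.2
    omega

lemma ValidIdx.exists_toIdx {k : ℕ} {i : Fin (k + 1) → ℕ} (hi : ValidIdx k i) :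
    ∃ e : ℕ →₀ ℕ, i = toIdx k e ∧ (∀ j, k < j → e j = 0) ∧ ∀ j, e (j + 1) ≤ e j := by
  have hlow : ∀ j : Fin (k + 1), k - (j : ℕ) + 1 ≤ i j := by
    intro j
    induction j using Fin.reverseInduction with
    | last => simpa using hi.1
    | cast j ih =>
      have := Fin.strictAnti_iff_succ_lt.1 hi.2 j
      have hj := j.2
      rw [Fin.val_succ] at ih
      rw [Fin.val_castSucc]
      omega
  have h1 : i = toIdx k (vecExp fun j : Fin (k + 1) => i j - (k - (j : ℕ) + 1)) := by
    funext j
    have := hlow j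
    simp only [toIdx, vecExp_apply, j.2, dite_true, Fin.eta]
    omega
  have h2 : ∀ j, k < j → vecExp (fun j : Fin (k + 1) => i j - (k - (j : ℕ) + 1)) j = 0 := by
    intro j hj
    rw [vecExp_apply, dif_neg (by omega)]
  refine ⟨_, h1, h2, fun j => ?_⟩
  rw [h1, validIdx_toIdx] at hi
  rcases lt_or_ge j k with hj | hj
  · exact hi j hj
  · rw [h2 (j + 1) (by omega)]
    exact Nat.zero_le _

lemma allDec_eq_decUpTo (k : ℕ) (i : Fin (k + 1) → ℕ) : allDec k i = decUpTo k k i := by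
  funext j
  simp [allDec, decUpTo, Nat.le_of_lt_succ j.2]

lemma decUpTo_toIdx {k m : ℕ} {e : ℕ →₀ ℕ} (h : headExp (m + 1) ≤ e) :
    decUpTo k m (toIdx k e) = toIdx k (e - headExp (m + 1)) := by
  funext j
  have := h j
  rw [headExp_apply] at this
  simp only [decUpTo, toIdx, Finsupp.tsub_apply, headExp_apply]
  split_ifs at this ⊢ <;> omega

lemma not_validIdx_decUpTo {k m : ℕ} (hm : m ≤ k) {e : ℕ →₀ ℕ} (he : ∀ j, e (j + 1) ≤ e j)
    (h : ¬ headExp (m + 1) ≤ e) : ¬ ValidIdx k (decUpTo k m (toIdx k e)) := by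
  have hanti : Antitone e := antitone_nat_of_succ_le he
  obtain ⟨j, hj⟩ := not_forall.1 h
  rw [headExp_apply] at hj
  have hjm : j ≤ m := by
    by_contra hjm
    rw [if_neg (by omega)] at hj
    omega
  have hem : e m = 0 := by
    rw [if_pos (by omega)] at hj
    have := hanti hjm
    omega
  intro hv
  rcases hm.lt_or_eq with hlt | rfl
  · have := Fin.strictAnti_iff_succ_lt.1 hv.2 ⟨m, hlt⟩
    simp [decUpTo, toIdx, hem] at this
    omega
  · have := hv.1
    simp [decUpTo, toIdx, hem] at this

lemma cast_toIdx (k : ℕ) (e : ℕ →₀ ℕ) (j : Fin (k + 1)) :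
    (toIdx k e j : ℝ) = (k : ℝ) - (j : ℕ) + 1 + e j := by
  simp [toIdx, Nat.cast_sub (Nat.le_of_lt_succ j.2)]

/-- Solution of the limiting recursion in terms of a sequence `J` satisfying the beta-integral
recursion. -/
lemma LimitRecursion.eq_coeff {k : ℕ} {δ : ℝ} (hδ : -1 < δ) {p : (Fin (k + 1) → ℕ) → ℝ}
    (hp : LimitRecursion k δ p) {α : ℝ}
    (hα : bcoef k δ 0 * α = tauc k δ + (k + 1) * (1 + δ)) {J : ℕ → ℝ}
    (hJ0 : J 0 = α⁻¹) (hJ : ∀ n : ℕ, (α + n + 1) * J (n + 1) = (n + 1) * J n)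
    {e : ℕ →₀ ℕ} (hsupp : ∀ j, k < j → e j = 0) (hmono : ∀ j, e (j + 1) ≤ e j) :
    p (toIdx k e) = tauc k δ / bcoef k δ 0 * J (e 0) *
      coeff e (degreeSeries (bcoef k δ) (1 + δ) (k + 1)) := by
  have hb : ∀ m ≤ k, bcoef k δ m ≠ 0 := fun m hm => (bcoef_pos hδ hm).ne'
  have hb0 := bcoef_pos hδ (Nat.zero_le k)
  have hk : (0 : ℝ) ≤ k := by positivity
  have hδ' : 0 < 1 + δ := by linarith
  have hτ : 0 < tauc k δ := by
    unfold tauc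
    nlinarith
  have hbδ : bcoef k δ 0 + δ = (k + 1) * (1 + δ) := by
    simp only [bcoef]
    push_cast
    ring
  have hα0 : 0 < α := by
    have h1 : 0 < bcoef k δ 0 * α := by rw [hα]; positivity
    exact (mul_pos_iff_of_pos_left hb0).1 h1
  set G := degreeSeries (bcoef k δ) (1 + δ) (k + 1) with hG
  induction hn : e 0 using Nat.strong_induction_on generalizing e with
  | _ n ih =>
  subst hn
  have hdec : ∀ m ≤ k, p (decUpTo k m (toIdx k e)) = if headExp (m + 1) ≤ e then
      tauc k δ / bcoef k δ 0 * J (e 0 - 1) * coeff (e - headExp (m + 1)) G else 0 := by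
    intro m hm
    split_ifs with hle
    · rw [decUpTo_toIdx hle]
      have h0 : (e - headExp (m + 1)) 0 = e 0 - 1 := by simp [headExp_apply]
      have hs : ∀ j, k < j → (e - headExp (m + 1)) j = 0 := fun j hj => by
        simp [hsupp j hj]
      by_cases hv : ∀ j, (e - headExp (m + 1)) (j + 1) ≤ (e - headExp (m + 1)) j
      · have he0 : 1 ≤ e 0 := by simpa [headExp_apply] using hle 0
        rw [ih (e 0 - 1) (by omega) hs hv h0]
      · have hc : coeff (e - headExp (m + 1)) G = 0 := by
          by_contra hc
          exact hv (coeff_degreeSeries_ne_zero _ _ _ _ hc)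
        rw [hc, mul_zero]
        refine hp.1 _ fun hv' => hv fun j => ?_
        rw [validIdx_toIdx] at hv'
        rcases lt_or_ge j k with hj | hj
        · exact hv' j hj
        · rw [hs (j + 1) (by omega)]
          exact Nat.zero_le _
    · exact hp.1 _ (not_validIdx_decUpTo hm hmono hle)
  have hrec := hp.2 _ ((validIdx_toIdx k e).2 fun j _ => hmono j)
  have hcoef := coeff_degreeSeries_rec (bcoef k δ) (1 + δ) hb e
  rw [← hG] at hcoef
  have hsum : (∑ m : Fin k,
          (((toIdx k e m.castSucc : ℝ) - 1 - k + (m : ℕ)) * bcoef k δ (m : ℕ)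
            - ((toIdx k e m.succ : ℝ) - k + (m : ℕ) + 1) * bcoef k δ ((m : ℕ) + 1)) / tauc k δ
            * p (decUpTo k (m : ℕ) (toIdx k e)))
      = (tauc k δ / bcoef k δ 0 * J (e 0 - 1)) / tauc k δ *
        ∑ m ∈ range k, if headExp (m + 1) ≤ e then
          (bcoef k δ m * ((e m : ℝ) - 1) - bcoef k δ (m + 1) * e (m + 1) + (1 + δ))
            * coeff (e - headExp (m + 1)) G else 0 := by
    rw [← Fin.sum_univ_eq_sum_range (fun m => if headExp (m + 1) ≤ e then
          (bcoef k δ m * ((e m : ℝ) - 1) - bcoef k δ (m + 1) * e (m + 1) + (1 + δ))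
            * coeff (e - headExp (m + 1)) G else 0), mul_sum]
    refine sum_congr rfl fun m _ => ?_
    rw [hdec m m.2.le, cast_toIdx, cast_toIdx]
    split_ifs
    · simp only [Fin.val_succ, Fin.val_castSucc, bcoef_succ]
      push_cast
      ring
    · simp
  have hlast : ((toIdx k e (Fin.last k) : ℝ) - 1 + δ) / tauc k δ * p (allDec k (toIdx k e))
      = (tauc k δ / bcoef k δ 0 * J (e 0 - 1)) / tauc k δ *
        if headExp (k + 1) ≤ e then
          (bcoef k δ k * ((e k : ℝ) - 1) + (1 + δ)) * coeff (e - headExp (k + 1)) G else 0 := by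
    rw [allDec_eq_decUpTo, hdec k le_rfl, cast_toIdx, bcoef_self]
    split_ifs
    · simp only [Fin.val_last]
      ring
    · simp
  have hind : (∀ ℓ : Fin (k + 1), toIdx k e ℓ = k - (ℓ : ℕ) + 1) ↔ e 0 = 0 := by
    refine ⟨fun h => ?_, fun h ℓ => ?_⟩
    · simpa [toIdx] using h 0
    · have := antitone_nat_of_succ_le hmono (Nat.zero_le ℓ)
      simp only [toIdx]
      omega
  rw [hsum, hlast, add_comm (_ * _ : ℝ) (_ * _ : ℝ), ← mul_add, ← hcoef, cast_toIdx] at hrec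
  simp only [hind] at hrec
  simp only [Fin.val_zero, Nat.cast_zero, sub_zero] at hrec
  have hmul : (bcoef k δ 0 * (α + e 0)) * p (toIdx k e)
      = tauc k δ * (J (e 0 - 1) * (e 0 * coeff e G)) + tauc k δ * (if e 0 = 0 then 1 else 0) := by
    field_simp at hrec
    linear_combination hrec + p (toIdx k e) * hα - p (toIdx k e) * hbδ
  rw [eq_comm, div_mul_eq_mul_div, div_mul_eq_mul_div, div_eq_iff hb0.ne']
  rcases h0 : e 0 with _ | n
  · have hz : e = 0 := by
      ext j
      have := antitone_nat_of_succ_le hmono (Nat.zero_le j)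
      rw [Finsupp.zero_apply]
      omega
    have hc : coeff e G = 1 := by rw [hz, hG, coeff_zero_degreeSeries]
    rw [h0] at hmul
    simp only [Nat.cast_zero, zero_mul, mul_zero, if_true] at hmul
    rw [hJ0, hc]
    field_simp
    linarith
  · rw [h0] at hmul
    simp only [add_tsub_cancel_right, Nat.add_eq_zero_iff, one_ne_zero, and_false, if_false] at hmul
    push_cast at hmul
    have hpos : α + n + 1 ≠ 0 := by positivity
    apply mul_left_cancel₀ hpos
    linear_combination tauc k δ * coeff e G * hJ n - hmul

end Recursion

/-- The random vector `(k-i+1 + T_i + Σ_{m=i+1}^k Σ_{j=1}^{T_m} N_{i,j}^{(m)})_{i=0}^k`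
of the compound negative-binomial construction, with the parameter `z` mixed over the
Pareto`(τ/b_0)` law, has the probability mass function `p` solving the limiting degree
recursion: for every valid index vector `i`,
`∫_1^∞ (τ/b_0) z^{-(1+τ/b_0)} P_z(D = i) dz = p_i`. -/
theorem representation_of_limit_pmf (k : ℕ) (δ : ℝ) (hδ : -1 < δ)
    (p : (Fin (k + 1) → ℕ) → ℝ) (hp : LimitRecursion k δ p) :
    ∀ i : Fin (k + 1) → ℕ, ValidIdx k i →
      (∫ z in Set.Ioi (1 : ℝ),
        (tauc k δ / bcoef k δ 0) * z ^ (-(1 + tauc k δ / bcoef k δ 0)) *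
          (Dlaw k δ z {i}).toReal) = p i := by
  intro i hi
  obtain ⟨e, rfl, hsupp, hmono⟩ := hi.exists_toIdx
  have hb0 := bcoef_pos hδ (Nat.zero_le k)
  have hk : (0 : ℝ) ≤ k := by positivity
  have hδ' : 0 < 1 + δ := by linarith
  have hτ : 0 < tauc k δ := by
    unfold tauc
    nlinarith
  set α := tauc k δ / bcoef k δ 0 + (k + 1) * ((1 + δ) / bcoef k δ 0) with hα
  have hα0 : 0 < α := by positivity
  rw [hp.eq_coeff hδ (α := α) (by rw [hα]; field_simp)
    (J := fun n => ∫ z in Set.Ioi (1 : ℝ), z ^ (-(1 + α)) * (1 - z⁻¹) ^ n)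
    (integral_pareto hα0) (integral_pareto_mul_pow_succ hα0) hsupp hmono,
    ← integral_const_mul, ← integral_mul_const]
  refine setIntegral_congr_fun measurableSet_Ioi fun z hz => ?_
  have hz : 1 < z := hz
  have hpow : z ^ (-(1 + α)) = z ^ (-(1 + tauc k δ / bcoef k δ 0))
      * (z ^ (-((1 + δ) / bcoef k δ 0))) ^ (k + 1) := by
    rw [← Real.rpow_natCast, ← Real.rpow_mul (by linarith), ← Real.rpow_add (by linarith), hα]
    congr 1
    push_cast
    ring
  simp only [Dlaw_toIdx hδ hz hsupp, hpow]
  ring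
end
end
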